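/- arXiv:1811.10069 — 3 statements merged into one kernel-verified Lean document; each statement's English description precedes it below -/
import Mathlib

section
/- Let k be an algebraically closed field and let a, b, c, d, A, B, C, E ∈ k with A ∈ {0,1} and, if A = 0, C ∈ {0,1}. Let T = T(a,b,c,d,0,0; A,B,C,0,E,0). Then the family (i,j,l) ↦ y^i·x^j·z^l (for i, j, l ≥ 0) is a k-vector-space basis of T if and only if exactly one of the following mutually exclusive cases holds: (i) d = 1 and E = 1; (ii) d ≠ 1, E = 1, and A = B = C = 0; (iii) d = 1, E ≠ 1, and a = b = c = 0; (iv) d ≠ 1, E ≠ 1, A = 0, c = 0, a·(E-1) = B·(d-1), and b·(E-1) = C·(d-1). -/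
noncomputable section

open FreeAlgebra

/-- The generator `x` of the free algebra `k⟨x,y,z⟩`. -/
def Xf (k : Type*) [Field k] : FreeAlgebra k (Fin 3) := FreeAlgebra.ι k 0

/-- The generator `y` of the free algebra `k⟨x,y,z⟩`. -/
def Yf (k : Type*) [Field k] : FreeAlgebra k (Fin 3) := FreeAlgebra.ι k 1

/-- The generator `z` of the free algebra `k⟨x,y,z⟩`. -/
def Zf (k : Type*) [Field k] : FreeAlgebra k (Fin 3) := FreeAlgebra.ι k 2

/-- The relations defining `T(a,b,c,d,e,f; A,B,C,D,E,F)`: `xy = yx`,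
`zx = a·x² + b·xy + c·y² + d·xz + e·yz + f·z²`, and
`zy = A·x² + B·xy + C·y² + D·xz + E·yz + F·z²`. -/
def Trel (k : Type*) [Field k] (a b c d e f A B C D E F : k) :
    FreeAlgebra k (Fin 3) → FreeAlgebra k (Fin 3) → Prop := fun m n =>
  (m = Xf k * Yf k ∧ n = Yf k * Xf k) ∨
  (m = Zf k * Xf k ∧
    n = a • (Xf k) ^ 2 + b • (Xf k * Yf k) + c • (Yf k) ^ 2 +
        d • (Xf k * Zf k) + e • (Yf k * Zf k) + f • (Zf k) ^ 2) ∨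
  (m = Zf k * Yf k ∧
    n = A • (Xf k) ^ 2 + B • (Xf k * Yf k) + C • (Yf k) ^ 2 +
        D • (Xf k * Zf k) + E • (Yf k * Zf k) + F • (Zf k) ^ 2)

/-- The algebra `T(a,b,c,d,e,f; A,B,C,D,E,F)`. -/
abbrev Talg (k : Type*) [Field k] (a b c d e f A B C D E F : k) :=
  RingQuot (Trel k a b c d e f A B C D E F)

/-- The image of `x` in `T`. -/
def Tx (k : Type*) [Field k] (a b c d e f A B C D E F : k) :
    Talg k a b c d e f A B C D E F :=
  RingQuot.mkAlgHom k (Trel k a b c d e f A B C D E F) (Xf k)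

/-- The image of `y` in `T`. -/
def Ty (k : Type*) [Field k] (a b c d e f A B C D E F : k) :
    Talg k a b c d e f A B C D E F :=
  RingQuot.mkAlgHom k (Trel k a b c d e f A B C D E F) (Yf k)

/-- The image of `z` in `T`. -/
def Tz (k : Type*) [Field k] (a b c d e f A B C D E F : k) :
    Talg k a b c d e f A B C D E F :=
  RingQuot.mkAlgHom k (Trel k a b c d e f A B C D E F) (Zf k)

/-- The property that the family `(i,j,l) ↦ y^i x^j z^l` is a `k`-vector-space basis of `T`;
following the paper, this is exactly the condition that `T` is a graded twisted tensor
product of `k[x,y]` and `k[z]`. -/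
def ThasBasis (k : Type*) [Field k] (a b c d e f A B C D E F : k) : Prop :=
  LinearIndependent k
      (fun p : ℕ × ℕ × ℕ =>
        (Ty k a b c d e f A B C D E F) ^ p.1 * (Tx k a b c d e f A B C D E F) ^ p.2.1 *
          (Tz k a b c d e f A B C D E F) ^ p.2.2) ∧
    Submodule.span k
      (Set.range fun p : ℕ × ℕ × ℕ =>
        (Ty k a b c d e f A B C D E F) ^ p.1 * (Tx k a b c d e f A B C D E F) ^ p.2.1 *
          (Tz k a b c d e f A B C D E F) ^ p.2.2) = ⊤

section OreExtension

variable {k : Type*} [Field k] (a b c d A B C E : k)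

section Relations

variable {R : Type*} [Ring R] [Algebra k R] {a b c d A B C E}

/-- Resolving the overlap `z * (x * y) = z * (y * x)` gives a cubic relation in `x` and `y`. -/
lemma overlap_relation {x y z : R} (hxy : x * y = y * x)
    (hzx : z * x = a • x ^ 2 + b • (x * y) + c • y ^ 2 + d • (x * z))
    (hzy : z * y = A • x ^ 2 + B • (x * y) + C • y ^ 2 + E • (y * z)) :
    ((d - 1) * A) • x ^ 3 + ((d - 1) * B - (E - 1) * a) • (y * x ^ 2) +
      ((d - 1) * C - (E - 1) * b) • (y ^ 2 * x) + ((1 - E) * c) • y ^ 3 = 0 := by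
  have h₁ : z * x * y = z * y * x := by rw [mul_assoc, hxy, mul_assoc]
  rw [hzx, hzy] at h₁
  have e₁ : x * z * y = x * (A • x ^ 2 + B • (x * y) + C • y ^ 2 + E • (y * z)) := by
    rw [mul_assoc, hzy]
  have e₂ : y * z * x = y * (a • x ^ 2 + b • (x * y) + c • y ^ 2 + d • (x * z)) := by
    rw [mul_assoc, hzx]
  have h₂ : x * (y * z) = y * (x * z) := by rw [← mul_assoc, hxy, mul_assoc]
  have h₃ : x * (y * y) = y * (y * x) := by rw [← mul_assoc, hxy, mul_assoc, hxy]
  have h₄ : x * (y * x) = y * (x * x) := by rw [← mul_assoc, hxy, mul_assoc]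
  simp only [add_mul, smul_mul_assoc, e₁, e₂] at h₁
  simp only [pow_succ, pow_zero, one_mul, mul_add, mul_smul_comm, smul_add, smul_smul, mul_assoc,
    hxy, h₂, h₃, h₄] at h₁ ⊢
  rw [← sub_eq_zero] at h₁
  rw [← h₁]
  module

/-- The monomials `y ^ i * x ^ j * z ^ l` span a subspace stable under left multiplication
by `x`, `y` and `z`. -/
lemma mul_mem_span_monomials {x y z : R} (hxy : x * y = y * x)
    (hzx : z * x = a • x ^ 2 + b • (x * y) + c • y ^ 2 + d • (x * z))
    (hzy : z * y = A • x ^ 2 + B • (x * y) + C • y ^ 2 + E • (y * z)) {t : R}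
    (ht : t ∈ Submodule.span k
      (Set.range fun p : ℕ × ℕ × ℕ => y ^ p.1 * x ^ p.2.1 * z ^ p.2.2)) :
    x * t ∈ Submodule.span k
        (Set.range fun p : ℕ × ℕ × ℕ => y ^ p.1 * x ^ p.2.1 * z ^ p.2.2) ∧
      y * t ∈ Submodule.span k
        (Set.range fun p : ℕ × ℕ × ℕ => y ^ p.1 * x ^ p.2.1 * z ^ p.2.2) ∧
      z * t ∈ Submodule.span k
        (Set.range fun p : ℕ × ℕ × ℕ => y ^ p.1 * x ^ p.2.1 * z ^ p.2.2) := by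
  set S := Submodule.span k
    (Set.range fun p : ℕ × ℕ × ℕ => y ^ p.1 * x ^ p.2.1 * z ^ p.2.2) with hS
  have mem (i j l : ℕ) : y ^ i * x ^ j * z ^ l ∈ S := Submodule.subset_span ⟨(i, j, l), rfl⟩
  have stable (w : R) (h : ∀ i j l : ℕ, w * (y ^ i * x ^ j * z ^ l) ∈ S) {s : R} (hs : s ∈ S) :
      w * s ∈ S := by
    have : S ≤ S.comap (LinearMap.mulLeft k w) := by
      rw [hS, Submodule.span_le]
      rintro _ ⟨p, rfl⟩
      exact h _ _ _
    exact this hs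
  have hx {s : R} (hs : s ∈ S) : x * s ∈ S := by
    refine stable x (fun i j l => ?_) hs
    have hc : x * y ^ i = y ^ i * x := (Commute.pow_right hxy i : Commute x (y ^ i))
    convert mem i (j + 1) l using 1
    rw [← mul_assoc, ← mul_assoc, hc, pow_succ', mul_assoc (y ^ i)]
  have hy {s : R} (hs : s ∈ S) : y * s ∈ S := by
    refine stable y (fun i j l => ?_) hs
    convert mem (i + 1) j l using 1
    rw [pow_succ']
    simp only [mul_assoc]
  have quad (α β γ : k) {s : R} (hs : s ∈ S) :
      (α • x ^ 2 + β • (x * y) + γ • y ^ 2) * s ∈ S := by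
    simp only [add_mul, smul_mul_assoc, pow_two, mul_assoc]
    exact S.add_mem (S.add_mem (S.smul_mem _ (hx (hx hs))) (S.smul_mem _ (hx (hy hs))))
      (S.smul_mem _ (hy (hy hs)))
  have hz (i j l : ℕ) : z * (y ^ i * x ^ j * z ^ l) ∈ S := by
    induction i with
    | zero =>
      induction j with
      | zero =>
        convert mem 0 0 (l + 1) using 1
        simp [pow_succ']
      | succ j ih =>
        have e : z * (y ^ 0 * x ^ (j + 1) * z ^ l) = z * x * (y ^ 0 * x ^ j * z ^ l) := by
          simp only [pow_zero, one_mul, pow_succ', mul_assoc]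
        rw [e, hzx, add_mul, smul_mul_assoc, mul_assoc x]
        exact S.add_mem (quad _ _ _ (mem _ _ _)) (S.smul_mem _ (hx ih))
    | succ i ih =>
      have e : z * (y ^ (i + 1) * x ^ j * z ^ l) = z * y * (y ^ i * x ^ j * z ^ l) := by
        simp only [pow_succ', mul_assoc]
      rw [e, hzy, add_mul, smul_mul_assoc, mul_assoc y]
      exact S.add_mem (quad _ _ _ (mem _ _ _)) (S.smul_mem _ (hy ih))
  exact ⟨hx ht, hy ht, stable z hz ht⟩

end Relations

section Quotient

lemma Tx_mul_Ty : Tx k a b c d 0 0 A B C 0 E 0 * Ty k a b c d 0 0 A B C 0 E 0 =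
    Ty k a b c d 0 0 A B C 0 E 0 * Tx k a b c d 0 0 A B C 0 E 0 := by
  have h := RingQuot.mkAlgHom_rel k
    (show Trel k a b c d 0 0 A B C 0 E 0 _ _ from Or.inl ⟨rfl, rfl⟩)
  rw [map_mul, map_mul] at h
  exact h

lemma Tz_mul_Tx : Tz k a b c d 0 0 A B C 0 E 0 * Tx k a b c d 0 0 A B C 0 E 0 =
    a • Tx k a b c d 0 0 A B C 0 E 0 ^ 2 +
      b • (Tx k a b c d 0 0 A B C 0 E 0 * Ty k a b c d 0 0 A B C 0 E 0) +
      c • Ty k a b c d 0 0 A B C 0 E 0 ^ 2 +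
      d • (Tx k a b c d 0 0 A B C 0 E 0 * Tz k a b c d 0 0 A B C 0 E 0) := by
  have h := RingQuot.mkAlgHom_rel k
    (show Trel k a b c d 0 0 A B C 0 E 0 _ _ from Or.inr (Or.inl ⟨rfl, rfl⟩))
  simp only [map_mul, map_add, map_smul, map_pow, zero_smul, add_zero] at h
  exact h

lemma Tz_mul_Ty : Tz k a b c d 0 0 A B C 0 E 0 * Ty k a b c d 0 0 A B C 0 E 0 =
    A • Tx k a b c d 0 0 A B C 0 E 0 ^ 2 +
      B • (Tx k a b c d 0 0 A B C 0 E 0 * Ty k a b c d 0 0 A B C 0 E 0) +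
      C • Ty k a b c d 0 0 A B C 0 E 0 ^ 2 +
      E • (Ty k a b c d 0 0 A B C 0 E 0 * Tz k a b c d 0 0 A B C 0 E 0) := by
  have h := RingQuot.mkAlgHom_rel k
    (show Trel k a b c d 0 0 A B C 0 E 0 _ _ from Or.inr (Or.inr ⟨rfl, rfl⟩))
  simp only [map_mul, map_add, map_smul, map_pow, zero_smul, add_zero] at h
  exact h

lemma span_monomials_eq_top : Submodule.span k
    (Set.range fun p : ℕ × ℕ × ℕ =>
      Ty k a b c d 0 0 A B C 0 E 0 ^ p.1 * Tx k a b c d 0 0 A B C 0 E 0 ^ p.2.1 *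
        Tz k a b c d 0 0 A B C 0 E 0 ^ p.2.2) = ⊤ := by
  set S := Submodule.span k
    (Set.range fun p : ℕ × ℕ × ℕ =>
      Ty k a b c d 0 0 A B C 0 E 0 ^ p.1 * Tx k a b c d 0 0 A B C 0 E 0 ^ p.2.1 *
        Tz k a b c d 0 0 A B C 0 E 0 ^ p.2.2) with hS
  have key (t : FreeAlgebra k (Fin 3)) :
      ∀ s ∈ S, RingQuot.mkAlgHom k (Trel k a b c d 0 0 A B C 0 E 0) t * s ∈ S := by
    induction t using FreeAlgebra.induction with
    | grade0 r =>
      intro s hs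
      rw [AlgHom.commutes, ← Algebra.smul_def]
      exact S.smul_mem r hs
    | grade1 i =>
      intro s hs
      obtain ⟨hx, hy, hz⟩ := mul_mem_span_monomials (Tx_mul_Ty a b c d A B C E)
        (Tz_mul_Tx a b c d A B C E) (Tz_mul_Ty a b c d A B C E) hs
      fin_cases i
      exacts [hx, hy, hz]
    | mul t u ht hu =>
      intro s hs
      rw [map_mul, mul_assoc]
      exact ht _ (hu _ hs)
    | add t u ht hu =>
      intro s hs
      rw [map_add, add_mul]
      exact S.add_mem (ht _ hs) (hu _ hs)
  rw [Submodule.eq_top_iff']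
  intro t
  obtain ⟨t, rfl⟩ := RingQuot.mkAlgHom_surjective k _ t
  have one_mem : (1 : Talg k a b c d 0 0 A B C 0 E 0) ∈ S :=
    Submodule.subset_span ⟨(0, 0, 0), by simp⟩
  simpa using key t 1 one_mem

variable {a b c d A B C E} in
/-- If the monomials are independent, all coefficients of the overlap relation vanish. -/
lemma coeffs_eq_zero_of_hasBasis (h : ThasBasis k a b c d 0 0 A B C 0 E 0) :
    (d - 1) * A = 0 ∧ (d - 1) * B - (E - 1) * a = 0 ∧
      (d - 1) * C - (E - 1) * b = 0 ∧ (E - 1) * c = 0 := by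
  have rel := overlap_relation (Tx_mul_Ty a b c d A B C E) (Tz_mul_Tx a b c d A B C E)
    (Tz_mul_Ty a b c d A B C E)
  have hinj : Function.Injective
      (![(0, 3, 0), (1, 2, 0), (2, 1, 0), (3, 0, 0)] : Fin 4 → ℕ × ℕ × ℕ) := by decide
  have hli := Fintype.linearIndependent_iff.1 (h.1.comp _ hinj)
    ![(d - 1) * A, (d - 1) * B - (E - 1) * a, (d - 1) * C - (E - 1) * b, (1 - E) * c]
    (by simpa [Fin.sum_univ_four] using rel)
  have hli₃ : (1 - E) * c = 0 := hli 3
  exact ⟨hli 0, hli 1, hli 2, by linear_combination -hli₃⟩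

end Quotient

section Representation

open MvPolynomial

open scoped IsMulCommutative in
/-- Commuting elements `M i` extend to an algebra homomorphism from a polynomial ring. -/
lemma exists_algHom_of_commute {ι R : Type*} [Ring R] [Algebra k R] (M : ι → R)
    (hM : ∀ i j, Commute (M i) (M j)) :
    ∃ φ : MvPolynomial ι k →ₐ[k] R, ∀ i, φ (X i) = M i := by
  have : IsMulCommutative (Algebra.adjoin k (Set.range M)) :=
    Algebra.isMulCommutative_adjoin k (by
      rintro _ ⟨i, rfl⟩ _ ⟨j, rfl⟩
      exact hM i j)
  let φ : MvPolynomial ι k →ₐ[k] Algebra.adjoin k (Set.range M) :=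
    aeval fun i => ⟨M i, Algebra.subset_adjoin ⟨i, rfl⟩⟩
  exact ⟨(Algebra.adjoin k (Set.range M)).val.comp φ, fun i => by simp [φ]⟩

/-- A skew derivation `δ` along an endomorphism `σ` scaling the variables, with prescribed
quadratic values on the variables; it is the upper right entry of a triangular representation. -/
lemma exists_skewDerivation (s q : Fin 2 → MvPolynomial (Fin 2) k)
    (h : s 0 * q 1 + q 0 * X 1 = s 1 * q 0 + q 1 * X 0) :
    ∃ σ δ : MvPolynomial (Fin 2) k →ₗ[k] MvPolynomial (Fin 2) k,
      σ 1 = 1 ∧ δ 1 = 0 ∧ (∀ i f, σ (X i * f) = s i * σ f) ∧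
        ∀ i f, δ (X i * f) = s i * δ f + q i * f := by
  obtain ⟨φ, hφ⟩ := exists_algHom_of_commute (k := k)
    (fun i : Fin 2 => !![s i, q i; 0, X i]) (by
      intro i j
      refine Matrix.ext fun u v => ?_
      fin_cases i <;> fin_cases j <;> fin_cases u <;> fin_cases v <;>
        simp [Matrix.mul_apply, Fin.sum_univ_two, mul_comm]
      all_goals first | linear_combination h | linear_combination -h)
  have hφ_lower (f) : φ f 1 0 = 0 ∧ φ f 1 1 = f := by
    induction f using MvPolynomial.induction_on with
    | C r =>
      rw [← algebraMap_eq, AlgHom.commutes]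
      simp [Matrix.algebraMap_matrix_apply]
    | add f g hf hg => simp [hf, hg]
    | mul_X f i hf => simp [hφ, Matrix.mul_apply, Fin.sum_univ_two, hf]
  refine ⟨(Matrix.entryLinearMap k _ 0 0).comp φ.toLinearMap,
    (Matrix.entryLinearMap k _ 0 1).comp φ.toLinearMap, by simp, by simp, fun i f => ?_,
    fun i f => ?_⟩
  all_goals
    rw [LinearMap.comp_apply, LinearMap.comp_apply, AlgHom.toLinearMap_apply, map_mul,
      Matrix.entryLinearMap_apply, Matrix.mul_apply, Fin.sum_univ_two]
    simp [hφ, hφ_lower]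

variable {a b c d A B C E}

/-- Operators satisfying the defining relations detect independence of the monomials. -/
lemma linearIndependent_monomials_of_module {V : Type*} [AddCommGroup V] [Module k V]
    {x y z : Module.End k V} (hxy : x * y = y * x)
    (hzx : z * x = a • x ^ 2 + b • (x * y) + c • y ^ 2 + d • (x * z))
    (hzy : z * y = A • x ^ 2 + B • (x * y) + C • y ^ 2 + E • (y * z)) (v : V)
    (hv : LinearIndependent k fun p : ℕ × ℕ × ℕ => (y ^ p.1 * x ^ p.2.1 * z ^ p.2.2) v) :
    LinearIndependent k fun p : ℕ × ℕ × ℕ =>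
      Ty k a b c d 0 0 A B C 0 E 0 ^ p.1 * Tx k a b c d 0 0 A B C 0 E 0 ^ p.2.1 *
        Tz k a b c d 0 0 A B C 0 E 0 ^ p.2.2 := by
  let ψ : Talg k a b c d 0 0 A B C 0 E 0 →ₐ[k] Module.End k V :=
    RingQuot.liftAlgHom k ⟨FreeAlgebra.lift k ![x, y, z], by
      rintro _ _ (⟨rfl, rfl⟩ | ⟨rfl, rfl⟩ | ⟨rfl, rfl⟩)
      · simpa [Xf, Yf] using hxy
      · simpa [Xf, Yf, Zf] using hzx
      · simpa [Xf, Yf, Zf] using hzy⟩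
  have hx : ψ (Tx k a b c d 0 0 A B C 0 E 0) = x := by simp [ψ, Tx, Xf]
  have hy : ψ (Ty k a b c d 0 0 A B C 0 E 0) = y := by simp [ψ, Ty, Yf]
  have hz : ψ (Tz k a b c d 0 0 A B C 0 E 0) = z := by simp [ψ, Tz, Zf]
  refine LinearIndependent.of_comp ((LinearMap.applyₗ v).comp ψ.toLinearMap) ?_
  convert hv using 2 with p
  simp [hx, hy, hz]

lemma linearIndependent_single_monomial :
    LinearIndependent k fun p : ℕ × ℕ × ℕ =>
      (Finsupp.single p.2.2 (X 1 ^ p.1 * X 0 ^ p.2.1) : ℕ →₀ MvPolynomial (Fin 2) k) := by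
  let e (p : ℕ × ℕ × ℕ) : (_ : ℕ) × (Fin 2 →₀ ℕ) :=
    ⟨p.2.2, Finsupp.single 1 p.1 + Finsupp.single 0 p.2.1⟩
  have he : Function.Injective e := by
    rintro ⟨i, j, l⟩ ⟨i', j', l'⟩ h
    obtain ⟨h₁, h₂⟩ := Sigma.mk.inj h
    have h₂ := eq_of_heq h₂
    have hi := DFunLike.congr_fun h₂ 1
    have hj := DFunLike.congr_fun h₂ 0
    simp at hi hj h₁
    simp [hi, hj, h₁]
  have h := (Finsupp.basis fun _ : ℕ => basisMonomials (Fin 2) k).linearIndependent.comp e he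
  simpa [e, Function.comp_def, X_pow_eq_monomial, monomial_mul] using h

/-- If the overlap relation is trivial, `T` acts faithfully enough on `k[x, y][z]` as an Ore
extension for the monomials to be independent. -/
theorem hasBasis_of_coeffs (h₁ : (d - 1) * A = 0) (h₂ : (d - 1) * B - (E - 1) * a = 0)
    (h₃ : (d - 1) * C - (E - 1) * b = 0) (h₄ : (E - 1) * c = 0) :
    ThasBasis k a b c d 0 0 A B C 0 E 0 := by
  refine ⟨?_, span_monomials_eq_top a b c d A B C E⟩
  obtain ⟨σ, δ, hσ₁, hδ₁, hσ, hδ⟩ := exists_skewDerivation (k := k)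
    ![d • X 0, E • X 1]
    ![a • X 0 ^ 2 + b • (X 0 * X 1) + c • X 1 ^ 2, A • X 0 ^ 2 + B • (X 0 * X 1) + C • X 1 ^ 2] (by
      have hC (r : k) (hr : r = 0) : (MvPolynomial.C r : MvPolynomial (Fin 2) k) = 0 := by
        simp [hr]
      replace h₁ := hC _ h₁
      replace h₂ := hC _ h₂
      replace h₃ := hC _ h₃
      replace h₄ := hC _ h₄
      simp only [map_mul, map_sub, map_one] at h₁ h₂ h₃ h₄
      simp only [Matrix.cons_val_zero, Matrix.cons_val_one, smul_eq_C_mul]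
      linear_combination X 0 ^ 3 * h₁ + X 0 ^ 2 * X 1 * h₂ + X 0 * X 1 ^ 2 * h₃ - X 1 ^ 3 * h₄)
  have hσx (f) : σ (X 0 * f) = d • (X 0 * σ f) := by rw [hσ, ← smul_mul_assoc]; rfl
  have hσy (f) : σ (X 1 * f) = E • (X 1 * σ f) := by rw [hσ, ← smul_mul_assoc]; rfl
  have hδx (f) : δ (X 0 * f) = d • (X 0 * δ f) +
      (a • (X 0 ^ 2 * f) + b • (X 0 * (X 1 * f)) + c • (X 1 ^ 2 * f)) := by
    simp only [hδ, Matrix.cons_val_zero, add_mul, smul_mul_assoc, mul_assoc]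
  have hδy (f) : δ (X 1 * f) = E • (X 1 * δ f) +
      (A • (X 0 ^ 2 * f) + B • (X 0 * (X 1 * f)) + C • (X 1 ^ 2 * f)) := by
    simp only [hδ, Matrix.cons_val_one, Matrix.cons_val_zero, add_mul, smul_mul_assoc, mul_assoc]
  let m (g : MvPolynomial (Fin 2) k) : Module.End k (ℕ →₀ MvPolynomial (Fin 2) k) :=
    Finsupp.mapRange.linearMap (LinearMap.mulLeft k g)
  let z : Module.End k (ℕ →₀ MvPolynomial (Fin 2) k) :=
    (Finsupp.lmapDomain _ k Nat.succ).comp (Finsupp.mapRange.linearMap σ) +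
      Finsupp.mapRange.linearMap δ
  have hm (g : MvPolynomial (Fin 2) k) (l : ℕ) (f : MvPolynomial (Fin 2) k) :
      m g (Finsupp.single l f) = Finsupp.single l (g * f) := by simp [m]
  have hz (l : ℕ) (f : MvPolynomial (Fin 2) k) :
      z (Finsupp.single l f) = Finsupp.single (l + 1) (σ f) + Finsupp.single l (δ f) := by
    simp [z, Finsupp.mapDomain_single]
  have hm_pow (g : MvPolynomial (Fin 2) k) (n l : ℕ) (f : MvPolynomial (Fin 2) k) :
      (m g ^ n) (Finsupp.single l f) = Finsupp.single l (g ^ n * f) := by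
    induction n with
    | zero => simp
    | succ n ih => rw [pow_succ', Module.End.mul_apply, ih, hm, pow_succ', mul_assoc]
  have hz_pow (n : ℕ) : (z ^ n) (Finsupp.single 0 1) = Finsupp.single n 1 := by
    induction n with
    | zero => simp
    | succ n ih => rw [pow_succ', Module.End.mul_apply, ih, hz, hσ₁, hδ₁, Finsupp.single_zero,
        add_zero]
  refine linearIndependent_monomials_of_module (x := m (X 0)) (y := m (X 1)) (z := z)
    ?_ ?_ ?_ (Finsupp.single 0 1) ?_
  · refine Finsupp.lhom_ext fun l f => ?_
    simp only [Module.End.mul_apply, hm]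
    rw [mul_left_comm]
  · refine Finsupp.lhom_ext fun l f => ?_
    simp only [Module.End.mul_apply, LinearMap.add_apply, LinearMap.smul_apply, hm_pow, hm, hz, hσx,
      hδx, map_add, smul_add, ← Finsupp.smul_single, Finsupp.single_add]
    abel
  · refine Finsupp.lhom_ext fun l f => ?_
    simp only [Module.End.mul_apply, LinearMap.add_apply, LinearMap.smul_apply, hm_pow, hm, hz, hσy,
      hδy, map_add, smul_add, ← Finsupp.smul_single, Finsupp.single_add]
    abel
  · simpa only [Module.End.mul_apply, hz_pow, hm_pow, mul_one] using
      linearIndependent_single_monomial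

theorem hasBasis_iff_coeffs : ThasBasis k a b c d 0 0 A B C 0 E 0 ↔
    (d - 1) * A = 0 ∧ (d - 1) * B - (E - 1) * a = 0 ∧
      (d - 1) * C - (E - 1) * b = 0 ∧ (E - 1) * c = 0 :=
  ⟨coeffs_eq_zero_of_hasBasis, fun ⟨h₁, h₂, h₃, h₄⟩ => hasBasis_of_coeffs h₁ h₂ h₃ h₄⟩

end Representation

end OreExtension

/-- Classification of Ore-type twisted tensor products with `e = 0` (Theorem 4.4(1)):
for `T = T(a,b,c,d,0,0; A,B,C,0,E,0)` with `A ∈ {0,1}` and `C ∈ {0,1}` when `A = 0`, the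
family `(i,j,l) ↦ y^i x^j z^l` is a `k`-basis of `T` iff exactly one of the four mutually
exclusive cases (i)-(iv) holds. -/
theorem stmt9 {k : Type*} [Field k] [IsAlgClosed k] (a b c d A B C E : k)
    (hA : A = 0 ∨ A = 1) (hC : A = 0 → C = 0 ∨ C = 1) :
    ThasBasis k a b c d 0 0 A B C 0 E 0 ↔
      ((d = 1 ∧ E = 1) ∨
       (d ≠ 1 ∧ E = 1 ∧ A = 0 ∧ B = 0 ∧ C = 0) ∨
       (d = 1 ∧ E ≠ 1 ∧ a = 0 ∧ b = 0 ∧ c = 0) ∨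
       (d ≠ 1 ∧ E ≠ 1 ∧ A = 0 ∧ c = 0 ∧ a * (E - 1) = B * (d - 1) ∧
         b * (E - 1) = C * (d - 1))) := by
  rw [hasBasis_iff_coeffs]
  by_cases hd : d = 1 <;> by_cases hE : E = 1
  · simp [hd, hE]
  · simp [hd, hE, sub_eq_zero]
  · simp [hd, hE, sub_eq_zero]
  · simp only [hd, hE, mul_eq_zero, sub_eq_zero, false_or, false_and, ne_eq, not_false_eq_true,
      true_and]
    constructor
    · rintro ⟨h₁, h₂, h₃, h₄⟩
      exact ⟨h₁, h₄, by linear_combination -h₂, by linear_combination -h₃⟩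
    · rintro ⟨h₁, h₂, h₃, h₄⟩
      exact ⟨h₁, by linear_combination -h₃, by linear_combination -h₄, h₂⟩
end
end

section
/- Let k be an algebraically closed field and a, d ∈ k such that f_n ≠ 0 for all n ≥ 1, where f_n ∈ k is computed from the pair (a,d). Let T° be the quotient of the free k-algebra k⟨x,y,z⟩ by the two-sided ideal generated by zx - a·x² - d·xz - z², zy, and xy. Then the family (i,j,l) ↦ y^i·x^j·z^l (for i, j, l ≥ 0) is a k-vector-space basis of T°; in particular the Hilbert series of T° is (1-t)^{-3}. -/
noncomputable section

open FreeAlgebra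

/-- The relations defining `T° = k⟨x,y,z⟩/⟨zx - a·x² - d·xz - z², zy, xy⟩`. -/
def T0rel (k : Type*) [Field k] (a d : k) :
    FreeAlgebra k (Fin 3) → FreeAlgebra k (Fin 3) → Prop := fun m n =>
  (m = Zf k * Xf k ∧ n = a • (Xf k) ^ 2 + d • (Xf k * Zf k) + (Zf k) ^ 2) ∨
  (m = Zf k * Yf k ∧ n = 0) ∨
  (m = Xf k * Yf k ∧ n = 0)

/-- The algebra `T°`. -/
abbrev T0alg (k : Type*) [Field k] (a d : k) := RingQuot (T0rel k a d)

/-- The image of `x` in `T°`. -/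
def T0x (k : Type*) [Field k] (a d : k) : T0alg k a d :=
  RingQuot.mkAlgHom k (T0rel k a d) (Xf k)

/-- The image of `y` in `T°`. -/
def T0y (k : Type*) [Field k] (a d : k) : T0alg k a d :=
  RingQuot.mkAlgHom k (T0rel k a d) (Yf k)

/-- The image of `z` in `T°`. -/
def T0z (k : Type*) [Field k] (a d : k) : T0alg k a d :=
  RingQuot.mkAlgHom k (T0rel k a d) (Zf k)

/-- The pair of sequences `(e_n, f_n)` associated to parameters `a, d`. -/
def efPair {k : Type*} [Field k] (a d : k) : ℕ → k × k
  | 0 => (1, 1)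
  | n + 1 => (d * (efPair a d n).1 + (efPair a d n).2,
              -a * (efPair a d n).1 + (efPair a d n).2)

/-- The sequence `f_n(a,d)`. -/
def fSeq {k : Type*} [Field k] (a d : k) (n : ℕ) : k := (efPair a d n).2

open Polynomial

namespace T0alg

section LeadingCoefficients

variable {k : Type*} [Field k]

/-- The scalar `c_n` for which `z ^ n * x - c_n • z ^ (n + 1)` is a combination of the
`x ^ j * z ^ m` with `m ≤ n`. -/
def leadScalar (a d : k) : ℕ → k
  | 0 => 0
  | n + 1 => (1 - a * leadScalar a d n)⁻¹ * (d * leadScalar a d n + 1)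

lemma fSeq_succ_eq_of_mul_fSeq {a d c : k} {n : ℕ} (h : c * fSeq a d n = (efPair a d n).1) :
    fSeq a d (n + 1) = (1 - a * c) * fSeq a d n := by
  rw [sub_mul, mul_assoc, h]
  simp only [fSeq, efPair]
  ring

lemma leadScalar_succ_mul_fSeq {a d : k} (hf : ∀ n : ℕ, 1 ≤ n → fSeq a d n ≠ 0) (n : ℕ) :
    leadScalar a d (n + 1) * fSeq a d n = (efPair a d n).1 := by
  induction n with
  | zero => simp [leadScalar, fSeq, efPair]
  | succ n ih =>
    have hs := fSeq_succ_eq_of_mul_fSeq ih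
    have h0 : 1 - a * leadScalar a d (n + 1) ≠ 0 :=
      left_ne_zero_of_mul (hs ▸ hf (n + 1) (by omega))
    rw [leadScalar, hs, mul_comm _ (fSeq a d n), mul_comm (_⁻¹), mul_assoc, mul_left_comm (_⁻¹),
      inv_mul_cancel₀ h0, mul_one, add_mul, mul_assoc, ih]
    simp [efPair, fSeq]

lemma one_sub_mul_leadScalar_ne_zero {a d : k} (hf : ∀ n : ℕ, 1 ≤ n → fSeq a d n ≠ 0) (n : ℕ) :
    1 - a * leadScalar a d n ≠ 0 := by
  cases n with
  | zero => simp [leadScalar]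
  | succ n =>
    have hs := fSeq_succ_eq_of_mul_fSeq (leadScalar_succ_mul_fSeq hf n)
    exact left_ne_zero_of_mul (hs ▸ hf (n + 1) (by omega))

lemma one_sub_smul_eq {M : Type*} [AddCommMonoid M] [Module k M] {u : k} {t r : M}
    (h : t = u • t + r) : (1 - u) • t = r := by
  calc (1 - u) • t = t + (-u) • t := by rw [sub_eq_add_neg, add_smul, one_smul]
    _ = (u • t + r) + (-u) • t := by rw [← h]
    _ = (u + -u) • t + r := by rw [add_smul]; abel
    _ = r := by rw [add_neg_cancel, zero_smul, zero_add]

end LeadingCoefficients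

section Relations

variable {k : Type*} [Field k] (a d : k)

lemma z_mul_x : T0z k a d * T0x k a d =
    a • (T0x k a d) ^ 2 + d • (T0x k a d * T0z k a d) + (T0z k a d) ^ 2 := by
  have h := RingQuot.mkAlgHom_rel k (s := T0rel k a d) (Or.inl ⟨rfl, rfl⟩)
  simp only [map_mul, map_add, map_smul, map_pow] at h
  exact h

lemma z_mul_y : T0z k a d * T0y k a d = 0 := by
  have h := RingQuot.mkAlgHom_rel k (s := T0rel k a d) (Or.inr (Or.inl ⟨rfl, rfl⟩))
  simp only [map_mul, map_zero] at h
  exact h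

lemma x_mul_y : T0x k a d * T0y k a d = 0 := by
  have h := RingQuot.mkAlgHom_rel k (s := T0rel k a d) (Or.inr (Or.inr ⟨rfl, rfl⟩))
  simp only [map_mul, map_zero] at h
  exact h

end Relations

section Spanning

variable {k : Type*} [Field k] (a d : k)

/-- The span of the `x ^ j * z ^ m` with `m ≤ n`. -/
def xzSpan (n : ℕ) : Submodule k (T0alg k a d) :=
  Submodule.span k {t | ∃ j m, m ≤ n ∧ (T0x k a d) ^ j * (T0z k a d) ^ m = t}

variable {a d}

lemma x_pow_mul_z_pow_mem_xzSpan (j : ℕ) {m n : ℕ} (h : m ≤ n) :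
    (T0x k a d) ^ j * (T0z k a d) ^ m ∈ xzSpan a d n :=
  Submodule.subset_span ⟨j, m, h, rfl⟩

lemma xzSpan_mono {m n : ℕ} (h : m ≤ n) : xzSpan a d m ≤ xzSpan a d n :=
  Submodule.span_mono fun _ ⟨j, i, hi, e⟩ => ⟨j, i, hi.trans h, e⟩

lemma x_pow_mul_mem_xzSpan (j : ℕ) {n : ℕ} {w : T0alg k a d} (hw : w ∈ xzSpan a d n) :
    (T0x k a d) ^ j * w ∈ xzSpan a d n := by
  refine Submodule.span_induction (p := fun w _ => (T0x k a d) ^ j * w ∈ xzSpan a d n)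
    ?_ (by simp) (fun u v _ _ hu hv => ?_) (fun c u _ hu => ?_) hw
  · rintro _ ⟨i, m, hm, rfl⟩
    rw [← mul_assoc, ← pow_add]
    exact x_pow_mul_z_pow_mem_xzSpan _ hm
  · rw [mul_add]
    exact add_mem hu hv
  · rw [mul_smul_comm]
    exact Submodule.smul_mem _ _ hu

lemma mul_z_mem_xzSpan {n : ℕ} {w : T0alg k a d} (hw : w ∈ xzSpan a d n) :
    w * T0z k a d ∈ xzSpan a d (n + 1) := by
  refine Submodule.span_induction (p := fun w _ => w * T0z k a d ∈ xzSpan a d (n + 1))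
    ?_ (by simp) (fun u v _ _ hu hv => ?_) (fun c u _ hu => ?_) hw
  · rintro _ ⟨i, m, hm, rfl⟩
    rw [mul_assoc, ← pow_succ]
    exact x_pow_mul_z_pow_mem_xzSpan _ (by omega)
  · rw [add_mul]
    exact add_mem hu hv
  · rw [smul_mul_assoc]
    exact Submodule.smul_mem _ _ hu

lemma mul_x_mem_xzSpan {n : ℕ}
    (h : ∀ m ≤ n, (T0z k a d) ^ m * T0x k a d ∈ xzSpan a d (n + 1))
    {w : T0alg k a d} (hw : w ∈ xzSpan a d n) :
    w * T0x k a d ∈ xzSpan a d (n + 1) := by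
  refine Submodule.span_induction (p := fun w _ => w * T0x k a d ∈ xzSpan a d (n + 1))
    ?_ (by simp) (fun u v _ _ hu hv => ?_) (fun c u _ hu => ?_) hw
  · rintro _ ⟨i, m, hm, rfl⟩
    rw [mul_assoc]
    exact x_pow_mul_mem_xzSpan _ (h m hm)
  · rw [add_mul]
    exact add_mem hu hv
  · rw [smul_mul_assoc]
    exact Submodule.smul_mem _ _ hu

lemma z_pow_mem_xzSpan (n : ℕ) : (T0z k a d) ^ n ∈ xzSpan a d n := by
  simpa using x_pow_mul_z_pow_mem_xzSpan (k := k) (a := a) (d := d) 0 (le_refl n)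

lemma exists_z_pow_mul_x_eq (hc : ∀ n, 1 - a * leadScalar a d n ≠ 0) (n : ℕ) :
    ∃ w ∈ xzSpan a d n,
      (T0z k a d) ^ n * T0x k a d = leadScalar a d n • (T0z k a d) ^ (n + 1) + w := by
  induction n using Nat.strong_induction_on with
  | _ n ih =>
  cases n with
  | zero =>
    refine ⟨T0x k a d, ?_, by simp [leadScalar]⟩
    simpa using x_pow_mul_z_pow_mem_xzSpan (a := a) (d := d) 1 (le_refl 0)
  | succ n =>
    obtain ⟨w, hw, e⟩ := ih n (by omega)
    have hwx : w * T0x k a d ∈ xzSpan a d (n + 1) := by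
      refine mul_x_mem_xzSpan (fun m hm => ?_) hw
      obtain ⟨v, hv, e'⟩ := ih m (by omega)
      rw [e']
      exact add_mem (Submodule.smul_mem _ _ (xzSpan_mono (by omega) (z_pow_mem_xzSpan (m + 1))))
        (xzSpan_mono (by omega) hv)
    have key : (1 - a * leadScalar a d n) • ((T0z k a d) ^ (n + 1) * T0x k a d) =
        (d * leadScalar a d n + 1) • (T0z k a d) ^ (n + 2) +
          (a • (w * T0x k a d) + d • (w * T0z k a d)) := by
      refine one_sub_smul_eq ?_
      have h : (T0z k a d) ^ (n + 1) * T0x k a d =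
          a • (((T0z k a d) ^ n * T0x k a d) * T0x k a d) +
          d • (((T0z k a d) ^ n * T0x k a d) * T0z k a d) + (T0z k a d) ^ (n + 2) := by
        rw [pow_succ, mul_assoc, z_mul_x]
        simp only [mul_add, mul_smul_comm, pow_succ, pow_zero, one_mul, mul_assoc]
      rw [e] at h
      nth_rewrite 1 [h]
      simp only [add_mul, smul_mul_assoc, ← pow_succ, smul_add, add_smul, mul_smul, one_smul]
      abel
    refine ⟨(1 - a * leadScalar a d n)⁻¹ • (a • (w * T0x k a d) + d • (w * T0z k a d)), ?_, ?_⟩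
    · exact Submodule.smul_mem _ _ (add_mem (Submodule.smul_mem _ _ hwx)
        (Submodule.smul_mem _ _ (mul_z_mem_xzSpan hw)))
    · rw [leadScalar, mul_smul, ← smul_add, ← key, inv_smul_smul₀ (hc n)]

lemma z_pow_mul_x_mem_xzSpan (hc : ∀ n, 1 - a * leadScalar a d n ≠ 0) (n : ℕ) :
    (T0z k a d) ^ n * T0x k a d ∈ xzSpan a d (n + 1) := by
  obtain ⟨w, hw, e⟩ := exists_z_pow_mul_x_eq hc n
  rw [e]
  exact add_mem (Submodule.smul_mem _ _ (z_pow_mem_xzSpan (n + 1))) (xzSpan_mono n.le_succ hw)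

variable (a d) in
/-- The family `y ^ i * x ^ j * z ^ l`. -/
def yxz (p : ℕ × ℕ × ℕ) : T0alg k a d :=
  (T0y k a d) ^ p.1 * (T0x k a d) ^ p.2.1 * (T0z k a d) ^ p.2.2

lemma y_pow_mul_mem_span (i : ℕ) {n : ℕ} {w : T0alg k a d} (hw : w ∈ xzSpan a d n) :
    (T0y k a d) ^ i * w ∈ Submodule.span k (Set.range (yxz a d)) := by
  refine Submodule.span_induction
    (p := fun w _ => (T0y k a d) ^ i * w ∈ Submodule.span k (Set.range (yxz a d)))
    ?_ (by simp) (fun u v _ _ hu hv => ?_) (fun c u _ hu => ?_) hw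
  · rintro _ ⟨j, m, -, rfl⟩
    exact Submodule.subset_span ⟨(i, j, m), mul_assoc _ _ _⟩
  · rw [mul_add]
    exact add_mem hu hv
  · rw [mul_smul_comm]
    exact Submodule.smul_mem _ _ hu

lemma yxz_mul_y_mem_span (p : ℕ × ℕ × ℕ) :
    yxz a d p * T0y k a d ∈ Submodule.span k (Set.range (yxz a d)) := by
  obtain ⟨i, j, l⟩ := p
  rcases l with _ | l
  · rcases j with _ | j
    · exact Submodule.subset_span ⟨(i + 1, 0, 0), by simp [yxz, pow_succ]⟩
    · simp [yxz, pow_succ, mul_assoc, x_mul_y]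
  · simp [yxz, pow_succ, mul_assoc, z_mul_y]

lemma span_mul_generator_mem (hc : ∀ n, 1 - a * leadScalar a d n ≠ 0) (g : Fin 3)
    {t : T0alg k a d} (ht : t ∈ Submodule.span k (Set.range (yxz a d))) :
    t * RingQuot.mkAlgHom k (T0rel k a d) (FreeAlgebra.ι k g) ∈
      Submodule.span k (Set.range (yxz a d)) := by
  refine Submodule.span_induction (p := fun t _ =>
    t * RingQuot.mkAlgHom k (T0rel k a d) (FreeAlgebra.ι k g) ∈
      Submodule.span k (Set.range (yxz a d)))
    ?_ (by simp) (fun u v _ _ hu hv => ?_) (fun c u _ hu => ?_) ht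
  · rintro _ ⟨p, rfl⟩
    fin_cases g
    · change yxz a d p * T0x k a d ∈ _
      rw [yxz, mul_assoc, mul_assoc]
      exact y_pow_mul_mem_span _ (x_pow_mul_mem_xzSpan _ (z_pow_mul_x_mem_xzSpan hc _))
    · exact yxz_mul_y_mem_span p
    · exact Submodule.subset_span ⟨(p.1, p.2.1, p.2.2 + 1), by
        change _ = yxz a d p * T0z k a d
        simp only [yxz, pow_succ, mul_assoc]⟩
  · rw [add_mul]
    exact add_mem hu hv
  · rw [smul_mul_assoc]
    exact Submodule.smul_mem _ _ hu

lemma span_yxz_eq_top (hc : ∀ n, 1 - a * leadScalar a d n ≠ 0) :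
    Submodule.span k (Set.range (yxz a d)) = ⊤ := by
  have h : ∀ w : FreeAlgebra k (Fin 3), ∀ t ∈ Submodule.span k (Set.range (yxz a d)),
      t * RingQuot.mkAlgHom k (T0rel k a d) w ∈ Submodule.span k (Set.range (yxz a d)) := by
    intro w
    induction w using FreeAlgebra.induction with
    | grade0 r =>
      intro t ht
      rw [AlgHom.commutes, ← Algebra.commutes, ← Algebra.smul_def]
      exact Submodule.smul_mem _ _ ht
    | grade1 g => exact fun t ht => span_mul_generator_mem hc g ht
    | mul u v hu hv =>
      intro t ht
      rw [map_mul, ← mul_assoc]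
      exact hv _ (hu t ht)
    | add u v hu hv =>
      intro t ht
      rw [map_add, mul_add]
      exact add_mem (hu t ht) (hv t ht)
  refine eq_top_iff.2 fun t _ => ?_
  obtain ⟨w, rfl⟩ := RingQuot.mkAlgHom_surjective k (T0rel k a d) t
  simpa using h w 1 (Submodule.subset_span ⟨(0, 0, 0), by simp [yxz]⟩)

end Spanning

section RightAction

variable {k : Type*} [Field k] {R : Type*} [CommRing R] [Algebra k R] (a d : k) (x : R)

/-- The normal form of `z ^ n * x`, as a polynomial in `z` with coefficients on the left. -/
def zPowMulX : ℕ → R[X]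
  | 0 => C x
  | n + 1 => (1 - a * leadScalar a d n)⁻¹ •
      (a • ∑ i : Fin (n + 1), (zPowMulX n).coeff i • zPowMulX i + d • (X * zPowMulX n) +
        X ^ (n + 2))
decreasing_by all_goals omega

lemma zPowMulX_coeff (n : ℕ) :
    (zPowMulX a d x n).coeff (n + 1) = algebraMap k R (leadScalar a d n) ∧
      ∀ m, n + 1 < m → (zPowMulX a d x n).coeff m = 0 := by
  induction n using Nat.strong_induction_on with
  | _ n ih =>
  cases n with
  | zero =>
    refine ⟨by simp [zPowMulX, leadScalar], fun m hm => ?_⟩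
    rw [zPowMulX, coeff_C_of_ne_zero (by omega)]
  | succ n =>
    have hsum : ∀ m, n + 1 < m → (∑ i : Fin (n + 1),
        (zPowMulX a d x n).coeff i • zPowMulX a d x i).coeff m = 0 := by
      intro m hm
      rw [finsetSum_coeff]
      refine Finset.sum_eq_zero fun i _ => ?_
      rw [coeff_smul, (ih i (by omega)).2 m (by omega), smul_zero]
    constructor
    · rw [zPowMulX, coeff_smul, coeff_add, coeff_add, coeff_smul, coeff_smul, hsum _ (by omega),
        coeff_X_mul, (ih n (by omega)).1, coeff_X_pow_self, leadScalar]
      simp [Algebra.smul_def]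
    · intro m hm
      obtain ⟨m, rfl⟩ : ∃ m', m = m' + 1 := ⟨m - 1, by omega⟩
      rw [zPowMulX, coeff_smul, coeff_add, coeff_add, coeff_smul, coeff_smul, hsum _ (by omega),
        coeff_X_mul, (ih n (by omega)).2 m (by omega), coeff_X_pow, if_neg (by omega)]
      simp

lemma dvd_coeff_zero_zPowMulX (n : ℕ) : x ∣ (zPowMulX a d x n).coeff 0 := by
  induction n using Nat.strong_induction_on with
  | _ n ih =>
  cases n with
  | zero => simp [zPowMulX]
  | succ n =>
    rw [zPowMulX, coeff_smul, coeff_add, coeff_add, coeff_smul, coeff_smul, coeff_X_mul_zero,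
      coeff_X_pow, if_neg (by omega), smul_zero, add_zero, add_zero, finsetSum_coeff]
    refine dvd_smul_of_dvd _ (dvd_smul_of_dvd _ (Finset.dvd_sum fun i _ => ?_))
    exact dvd_smul_of_dvd _ (ih i (by omega))

/-- Right multiplication by `x` on polynomials in `z` with coefficients on the left. -/
def mulX : R[X] →ₗ[R] R[X] :=
  Polynomial.lsum fun n => LinearMap.toSpanSingleton R R[X] (zPowMulX a d x n)

lemma mulX_apply (p : R[X]) : mulX a d x p = p.sum fun n c => c • zPowMulX a d x n := rfl

lemma mulX_monomial (n : ℕ) (c : R) : mulX a d x (monomial n c) = c • zPowMulX a d x n := by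
  rw [mulX_apply, sum_monomial_index _ (fun n c => c • zPowMulX a d x n) (zero_smul _ _)]

lemma mulX_zPowMulX (n : ℕ) :
    mulX a d x (zPowMulX a d x n) =
      ∑ i : Fin (n + 1), (zPowMulX a d x n).coeff i • zPowMulX a d x i +
        leadScalar a d n • zPowMulX a d x (n + 1) := by
  have hdeg : (zPowMulX a d x n).natDegree < n + 2 :=
    Nat.lt_succ_of_le (natDegree_le_iff_coeff_eq_zero.2 (zPowMulX_coeff a d x n).2)
  rw [mulX_apply,
    sum_over_range' (zPowMulX a d x n) (fun i => zero_smul R (zPowMulX a d x i)) _ hdeg,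
    Finset.sum_range_succ,
    Finset.sum_range, (zPowMulX_coeff a d x n).1, algebraMap_smul]

lemma mulX_X_mul (hc : ∀ n, 1 - a * leadScalar a d n ≠ 0) (p : R[X]) :
    mulX a d x (X * p) = a • mulX a d x (mulX a d x p) + d • (X * mulX a d x p) + X * (X * p) := by
  induction p using Polynomial.induction_on' with
  | add p q hp hq =>
    simp only [mul_add, map_add, hp, hq, smul_add]
    abel
  | monomial n c =>
    rw [X_mul_monomial, mulX_monomial, mulX_monomial, map_smul, mulX_zPowMulX]
    have key : zPowMulX a d x (n + 1) = a • (∑ i : Fin (n + 1),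
        (zPowMulX a d x n).coeff i • zPowMulX a d x i +
        leadScalar a d n • zPowMulX a d x (n + 1)) + d • (X * zPowMulX a d x n) + X ^ (n + 2) := by
      have h : (1 - a * leadScalar a d n) • zPowMulX a d x (n + 1) =
          a • ∑ i : Fin (n + 1), (zPowMulX a d x n).coeff i • zPowMulX a d x i +
            d • (X * zPowMulX a d x n) + X ^ (n + 2) := by
        rw [zPowMulX, smul_inv_smul₀ (hc n)]
      rw [sub_smul, one_smul, sub_eq_iff_eq_add] at h
      nth_rewrite 1 [h]
      module
    nth_rewrite 1 [key]
    rw [X_mul_monomial, smul_add c, smul_add c, smul_comm c a, smul_comm c d, mul_smul_comm,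
      X_pow_eq_monomial, smul_monomial, smul_eq_mul, mul_one]

end RightAction

section Independence

variable {k : Type*} [Field k] (a d : k)

/-- Right multiplication by `y` on `k[y][x][z]`. -/
def mulY (k : Type*) [Field k] : k[X][X][X] →ₗ[k] k[X][X][X] where
  toFun p := C (C (X * (p.coeff 0).coeff 0))
  map_add' p q := by simp [mul_add]
  map_smul' c p := by simp [← smul_C]

lemma mulY_apply (p : k[X][X][X]) : mulY k p = C (C (X * (p.coeff 0).coeff 0)) := rfl

lemma mulY_mulX (p : k[X][X][X]) : mulY k (mulX a d X p) = 0 := by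
  induction p using Polynomial.induction_on' with
  | add p q hp hq => rw [map_add, map_add, hp, hq, add_zero]
  | monomial n c =>
    obtain ⟨q, hq⟩ := dvd_coeff_zero_zPowMulX a d (X : k[X][X]) n
    rw [mulX_monomial, mulY_apply, coeff_smul, hq]
    simp

/-- The right action of the free generators on `k[y][x][z]`. -/
def generatorAction : Fin 3 → (Module.End k k[X][X][X])ᵐᵒᵖ :=
  ![MulOpposite.op ((mulX a d X).restrictScalars k), MulOpposite.op (mulY k),
    MulOpposite.op (LinearMap.mulLeft k X)]

variable {a d}

/-- The right action of `T°` on `k[y][x][z]`. -/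
def rightAction (hc : ∀ n, 1 - a * leadScalar a d n ≠ 0) :
    T0alg k a d →ₐ[k] (Module.End k k[X][X][X])ᵐᵒᵖ :=
  RingQuot.liftAlgHom k ⟨FreeAlgebra.lift k (generatorAction a d), by
    rintro _ _ (⟨rfl, rfl⟩ | ⟨rfl, rfl⟩ | ⟨rfl, rfl⟩)
    · simp only [Xf, Zf, map_mul, map_add, map_smul, map_pow, FreeAlgebra.lift_ι_apply]
      refine MulOpposite.unop_injective (LinearMap.ext fun p => ?_)
      simpa [generatorAction, pow_two] using mulX_X_mul a d X hc p
    · simp only [Yf, Zf, map_mul, map_zero, FreeAlgebra.lift_ι_apply]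
      refine MulOpposite.unop_injective (LinearMap.ext fun p => ?_)
      simp [generatorAction, mulY_apply]
    · simp only [Xf, Yf, map_mul, map_zero, FreeAlgebra.lift_ι_apply]
      refine MulOpposite.unop_injective (LinearMap.ext fun p => ?_)
      simpa [generatorAction] using mulY_mulX a d p⟩

lemma rightAction_generator (hc : ∀ n, 1 - a * leadScalar a d n ≠ 0) (g : Fin 3) :
    rightAction hc (RingQuot.mkAlgHom k (T0rel k a d) (FreeAlgebra.ι k g)) =
      generatorAction a d g := by
  rw [rightAction, RingQuot.liftAlgHom_mkAlgHom_apply, FreeAlgebra.lift_ι_apply]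

/-- The orbit map `t ↦ 1 * t` of the right action. -/
def orbitMap (hc : ∀ n, 1 - a * leadScalar a d n ≠ 0) : T0alg k a d →ₗ[k] k[X][X][X] :=
  LinearMap.applyₗ 1 ∘ₗ (MulOpposite.opLinearEquiv k).symm.toLinearMap ∘ₗ
    (rightAction hc).toLinearMap

lemma orbitMap_apply (hc : ∀ n, 1 - a * leadScalar a d n ≠ 0) (t : T0alg k a d) :
    orbitMap hc t = (rightAction hc t).unop 1 := rfl

lemma orbitMap_mul (hc : ∀ n, 1 - a * leadScalar a d n ≠ 0) (s t : T0alg k a d) :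
    orbitMap hc (s * t) = (rightAction hc t).unop (orbitMap hc s) := by
  rw [orbitMap_apply, map_mul]
  rfl

lemma orbitMap_mul_x (hc : ∀ n, 1 - a * leadScalar a d n ≠ 0) (t : T0alg k a d) :
    orbitMap hc (t * T0x k a d) = mulX a d X (orbitMap hc t) := by
  rw [orbitMap_mul, T0x, Xf, rightAction_generator]
  rfl

lemma orbitMap_mul_y (hc : ∀ n, 1 - a * leadScalar a d n ≠ 0) (t : T0alg k a d) :
    orbitMap hc (t * T0y k a d) = mulY k (orbitMap hc t) := by
  rw [orbitMap_mul, T0y, Yf, rightAction_generator]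
  rfl

lemma orbitMap_mul_z (hc : ∀ n, 1 - a * leadScalar a d n ≠ 0) (t : T0alg k a d) :
    orbitMap hc (t * T0z k a d) = X * orbitMap hc t := by
  rw [orbitMap_mul, T0z, Zf, rightAction_generator]
  rfl

lemma orbitMap_y_pow (hc : ∀ n, 1 - a * leadScalar a d n ≠ 0) (i : ℕ) :
    orbitMap hc ((T0y k a d) ^ i) = C (C (X ^ i)) := by
  induction i with
  | zero => simp [orbitMap_apply]
  | succ i ih =>
    rw [pow_succ, orbitMap_mul_y, ih, mulY_apply, coeff_C_zero, coeff_C_zero, pow_succ']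

lemma orbitMap_y_pow_mul_x_pow (hc : ∀ n, 1 - a * leadScalar a d n ≠ 0) (i j : ℕ) :
    orbitMap hc ((T0y k a d) ^ i * (T0x k a d) ^ j) = C (monomial j (X ^ i)) := by
  induction j with
  | zero => rw [pow_zero, mul_one, orbitMap_y_pow, monomial_zero_left]
  | succ j ih =>
    rw [pow_succ, ← mul_assoc, orbitMap_mul_x, ih, ← monomial_zero_left, mulX_monomial, zPowMulX,
      smul_C, smul_eq_mul, monomial_mul_X]

lemma orbitMap_yxz (hc : ∀ n, 1 - a * leadScalar a d n ≠ 0) (i j l : ℕ) :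
    orbitMap hc (yxz a d (i, j, l)) = monomial l (monomial j (monomial i 1)) := by
  dsimp only [yxz]
  induction l with
  | zero =>
    rw [pow_zero, mul_one, orbitMap_y_pow_mul_x_pow, monomial_zero_left, X_pow_eq_monomial]
  | succ l ih => rw [pow_succ, ← mul_assoc, orbitMap_mul_z, ih, X_mul_monomial]

lemma linearIndependent_yxz (hc : ∀ n, 1 - a * leadScalar a d n ≠ 0) :
    LinearIndependent k (yxz a d) := by
  let b := (basisMonomials k).smulTower
    ((basisMonomials k[X]).smulTower (basisMonomials k[X][X]))
  refine LinearIndependent.of_comp (orbitMap hc) ?_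
  convert b.linearIndependent using 1
  ext1 ⟨i, j, l⟩
  rw [Function.comp_apply, orbitMap_yxz]
  simp [b, Module.Basis.smulTower_apply, smul_monomial]

end Independence

end T0alg

/-- If `f_n(a,d) ≠ 0` for all `n ≥ 1`, then the family `(i,j,l) ↦ y^i x^j z^l` is a
`k`-vector-space basis of `T°`; in particular the Hilbert series of `T°` is `(1-t)^{-3}`. -/
theorem stmt12 {k : Type*} [Field k] [IsAlgClosed k] (a d : k)
    (hf : ∀ n : ℕ, 1 ≤ n → fSeq a d n ≠ 0) :
    LinearIndependent k
        (fun p : ℕ × ℕ × ℕ => (T0y k a d) ^ p.1 * (T0x k a d) ^ p.2.1 * (T0z k a d) ^ p.2.2) ∧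
      Submodule.span k
        (Set.range fun p : ℕ × ℕ × ℕ =>
          (T0y k a d) ^ p.1 * (T0x k a d) ^ p.2.1 * (T0z k a d) ^ p.2.2) = ⊤ := by
  have hc := T0alg.one_sub_mul_leadScalar_ne_zero hf
  exact ⟨T0alg.linearIndependent_yxz hc, T0alg.span_yxz_eq_top hc⟩
end
end

section
/- Let k be an algebraically closed field and let a, b, c, d, e, A, B, C, E ∈ k with e ∈ {0,1}, with A ∈ {0,1} if e = 0, and with d = E if e = 1. Let T = T(a,b,c,d,e,1; A,B,C,0,E,0), and suppose the family (i,j,l) ↦ y^i·x^j·z^l (for i, j, l ≥ 0) is a k-vector-space basis of T. If the element G₂ of the free algebra k⟨x,y,z⟩ is nonzero, where G₂ = -A·zx² - AE·x²z + (A - dA - AB)·x³ + (E - BE - E²)·yzx - (dE + BE - dE²)·yxz + (B - a - dB - B² - AC - ACE + aE² - eA)·yx² - (CE² + CE + eE - eE²)·y²z + (C - b - dC - 2BC - BCE + bE² - eB)·y²x - (c + C² + C²E - cE² + eC)·y³, then A = 1, e = 0, d = -1, E = -1, and b = (1-a)·(2-B). -/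
noncomputable section

open FreeAlgebra

/-- The element `G₂` of the free algebra `k⟨x,y,z⟩`. -/
def G2elt (k : Type*) [Field k] (a b c d e A B C E : k) : FreeAlgebra k (Fin 3) :=
  -(A • (Zf k * (Xf k) ^ 2)) - (A * E) • ((Xf k) ^ 2 * Zf k) +
    (A - d * A - A * B) • (Xf k) ^ 3 +
    (E - B * E - E ^ 2) • (Yf k * Zf k * Xf k) -
    (d * E + B * E - d * E ^ 2) • (Yf k * Xf k * Zf k) +
    (B - a - d * B - B ^ 2 - A * C - A * C * E + a * E ^ 2 - e * A) • (Yf k * (Xf k) ^ 2) -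
    (C * E ^ 2 + C * E + e * E - e * E ^ 2) • ((Yf k) ^ 2 * Zf k) +
    (C - b - d * C - 2 * B * C - B * C * E + b * E ^ 2 - e * B) • ((Yf k) ^ 2 * Xf k) -
    (c + C ^ 2 + C ^ 2 * E - c * E ^ 2 + e * C) • (Yf k) ^ 3

section Consequences

variable {k T : Type*} [Field k] [Ring T] [Algebra k T] {a b c d e A B C E : k} {x y z : T}

/-- The relation coming from `z(xy - yx) = 0`, seen by a functional that kills `yT`. -/
theorem overlap_zxy (hxy : x * y = y * x)
    (hzx : z * x = a • (x * x) + b • (y * x) + c • (y * y) + d • (x * z) + e • (y * z) + z * z)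
    (hzy : z * y = A • (x * x) + B • (y * x) + C • (y * y) + E • (y * z))
    (φ : T →ₗ[k] k) (hφ : ∀ t, φ (y * t) = 0) :
    A * φ (x * (x * x)) = d * A * φ (x * (x * x)) + A * φ (z * (x * x)) +
      B * A * φ (x * (x * x)) + E * A * φ (x * (x * z)) := by
  have hxy' : ∀ t, x * (y * t) = y * (x * t) := fun t => by
    rw [← mul_assoc, hxy, mul_assoc]
  have hzy' : ∀ t, z * (y * t) = A • (x * (x * t)) + B • (y * (x * t)) + C • (y * (y * t)) +
      E • (y * (z * t)) := fun t => by
    rw [← mul_assoc, hzy]; simp only [add_mul, smul_mul_assoc, mul_assoc]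
  have h1 := congrArg φ (congrArg (· * y) hzx)
  have h2 := congrArg φ (congrArg (z * ·) hzy)
  simp only [add_mul, mul_add, smul_mul_assoc, mul_smul_comm, mul_assoc, hxy, hxy', hzy, hzy',
    map_add, map_smul, hφ, smul_eq_mul, smul_add] at h1 h2
  linear_combination h1

/-- The value of a functional killing `yT` on `zx²`, in terms of its values on the
monomials `x^j z^l`. -/
theorem apply_zxx (hxy : x * y = y * x)
    (hzx : z * x = a • (x * x) + b • (y * x) + c • (y * y) + d • (x * z) + e • (y * z) + z * z)
    (hzy : z * y = A • (x * x) + B • (y * x) + C • (y * y) + E • (y * z))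
    (φ : T →ₗ[k] k) (hφ : ∀ t, φ (y * t) = 0) :
    (1 - a) * φ (z * (x * x)) = (a + d * a + b * A) * φ (x * (x * x)) +
      (d ^ 2 + d * a + e * A) * φ (x * (x * z)) + (d + d ^ 2) * φ (x * (z * z)) +
      (1 + d) * φ (z * (z * z)) := by
  have hxy' : ∀ t, x * (y * t) = y * (x * t) := fun t => by
    rw [← mul_assoc, hxy, mul_assoc]
  have hzy' : ∀ t, z * (y * t) = A • (x * (x * t)) + B • (y * (x * t)) + C • (y * (y * t)) +
      E • (y * (z * t)) := fun t => by
    rw [← mul_assoc, hzy]; simp only [add_mul, smul_mul_assoc, mul_assoc]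
  have h1 := congrArg φ (congrArg (· * x) hzx)
  have h2 := congrArg φ (congrArg (z * ·) hzx)
  have h3 := congrArg φ (congrArg (x * ·) hzx)
  have h4 := congrArg φ (congrArg (· * z) hzx)
  simp only [add_mul, mul_add, smul_mul_assoc, mul_smul_comm, mul_assoc, hxy, hxy', hzy, hzy',
    map_add, map_smul, hφ, smul_eq_mul, smul_add] at h1 h2 h3 h4
  linear_combination h1 + h2 + d * h3 + d * h4

/-- The full overlap relation when `A = 0`. -/
theorem overlap_zxy_of_A_eq_zero (hxy : x * y = y * x)
    (hzx : z * x = a • (x * x) + b • (y * x) + c • (y * y) + d • (x * z) + e • (y * z) + z * z)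
    (hzy : z * y = B • (y * x) + C • (y * y) + E • (y * z)) (φ : T →ₗ[k] k) :
    (E - B * E - E ^ 2) * φ (y * (z * x)) - (d * E + B * E - d * E ^ 2) * φ (y * (x * z)) +
      (B - a - d * B - B ^ 2 + a * E ^ 2) * φ (y * (x * x)) -
      (C * E ^ 2 + C * E + e * E - e * E ^ 2) * φ (y * (y * z)) +
      (C - b - d * C - 2 * B * C - B * C * E + b * E ^ 2 - e * B) * φ (y * (y * x)) -
      (c + C ^ 2 + C ^ 2 * E - c * E ^ 2 + e * C) * φ (y * (y * y)) = 0 := by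
  have hxy' : ∀ t, x * (y * t) = y * (x * t) := fun t => by
    rw [← mul_assoc, hxy, mul_assoc]
  have hzy' : ∀ t, z * (y * t) = B • (y * (x * t)) + C • (y * (y * t)) +
      E • (y * (z * t)) := fun t => by
    rw [← mul_assoc, hzy]; simp only [add_mul, smul_mul_assoc, mul_assoc]
  have h1 := congrArg φ (congrArg (· * y) hzx)
  have h2 := congrArg φ (congrArg (y * ·) hzx)
  simp only [add_mul, mul_add, smul_mul_assoc, mul_smul_comm, mul_assoc, hxy, hxy', hzy, hzy',
    map_add, map_smul, smul_eq_mul, smul_add] at h1 h2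
  linear_combination h1 - E ^ 2 * h2

end Consequences

theorem G2elt_eq_zero_of_coeffs {k : Type*} [Field k] {a b c d e B C E : k}
    (hp : E - B * E - E ^ 2 = 0) (hq : d * E + B * E - d * E ^ 2 = 0)
    (hr : B - a - d * B - B ^ 2 + a * E ^ 2 = 0)
    (hs : C * E ^ 2 + C * E + e * E - e * E ^ 2 = 0)
    (ht : C - b - d * C - 2 * B * C - B * C * E + b * E ^ 2 - e * B = 0)
    (hu : c + C ^ 2 + C ^ 2 * E - c * E ^ 2 + e * C = 0) :
    G2elt k a b c d e 0 B C E = 0 := by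
  simp [G2elt, hp, hq, hr, hs, ht, hu]

/-- If `T = T(a,b,c,d,e,1; A,B,C,0,E,0)` is in Jordan normal form (`e ∈ {0,1}`,
`A ∈ {0,1}` when `e = 0`, `d = E` when `e = 1`), the family `(i,j,l) ↦ y^i x^j z^l` is a
`k`-basis of `T`, and `G₂ ≠ 0` in the free algebra, then `A = 1`, `e = 0`, `d = -1`,
`E = -1`, and `b = (1-a)(2-B)`. -/
theorem stmt14 {k : Type*} [Field k] [IsAlgClosed k] (a b c d e A B C E : k)
    (he : e = 0 ∨ e = 1) (hA : e = 0 → A = 0 ∨ A = 1) (hdE : e = 1 → d = E)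
    (hbasis : ThasBasis k a b c d e 1 A B C 0 E 0)
    (hG2 : G2elt k a b c d e A B C E ≠ 0) :
    A = 1 ∧ e = 0 ∧ d = -1 ∧ E = -1 ∧ b = (1 - a) * (2 - B) := by
  obtain ⟨hli, hspan⟩ := hbasis
  have hxy := RingQuot.mkAlgHom_rel k (s := Trel k a b c d e 1 A B C 0 E 0)
    (Or.inl ⟨rfl, rfl⟩)
  have hzx := RingQuot.mkAlgHom_rel k (s := Trel k a b c d e 1 A B C 0 E 0)
    (Or.inr (Or.inl ⟨rfl, rfl⟩))
  have hzy := RingQuot.mkAlgHom_rel k (s := Trel k a b c d e 1 A B C 0 E 0)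
    (Or.inr (Or.inr ⟨rfl, rfl⟩))
  simp only [map_mul, map_add, map_smul, pow_two, one_smul, zero_smul, add_zero]
    at hxy hzx hzy
  unfold Tx Ty Tz at hli hspan
  generalize RingQuot.mkAlgHom k (Trel k a b c d e 1 A B C 0 E 0) (Xf k) = x at *
  generalize RingQuot.mkAlgHom k (Trel k a b c d e 1 A B C 0 E 0) (Yf k) = y at *
  generalize RingQuot.mkAlgHom k (Trel k a b c d e 1 A B C 0 E 0) (Zf k) = z at *
  rw [hxy] at hzx hzy
  let β := Module.Basis.mk hli hspan.ge
  have hβ : ∀ i j l, β (i, j, l) = y ^ i * x ^ j * z ^ l := fun i j l => by simp [β]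
  have hcoord : ∀ p i j l, β.coord p (y ^ i * x ^ j * z ^ l) =
      if (i, j, l) = p then 1 else 0 := fun p i j l => by
    rw [← hβ, Module.Basis.coord_apply, Module.Basis.repr_self, Finsupp.single_apply]
  have hkill : ∀ j l t, β.coord (0, j, l) (y * t) = 0 := by
    intro j l t
    have : β.coord (0, j, l) ∘ₗ LinearMap.mulLeft k y = 0 := by
      refine β.ext fun ⟨i, j', l'⟩ => ?_
      have := hcoord (0, j, l) (i + 1) j' l'
      rw [pow_succ'] at this
      simpa [hβ, mul_assoc] using this
    simpa using LinearMap.congr_fun this t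
  have hA0 : A ≠ 0 := by
    rintro rfl
    rw [zero_smul, zero_add] at hzy
    have key := fun p => overlap_zxy_of_A_eq_zero hxy hzx hzy (β.coord p)
    have hyzx : y * (z * x) = a • (y * (x * x)) + b • (y * (y * x)) + c • (y * (y * y)) +
        d • (y * (x * z)) + e • (y * (y * z)) + y * (z * z) := by
      rw [hzx]; simp only [mul_add, mul_smul_comm]
    have e1 := fun p => hcoord p 1 2 0
    have e2 := fun p => hcoord p 2 1 0
    have e3 := fun p => hcoord p 3 0 0
    have e4 := fun p => hcoord p 1 1 1
    have e5 := fun p => hcoord p 2 0 1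
    have e6 := fun p => hcoord p 1 0 2
    simp only [pow_succ, pow_zero, one_mul, mul_one, mul_assoc] at e1 e2 e3 e4 e5 e6
    simp only [hyzx, map_add, map_smul, smul_eq_mul, e1, e2, e3, e4, e5, e6] at key
    have k6 := key (1, 0, 2)
    have k4 := key (1, 1, 1)
    have k1 := key (1, 2, 0)
    have k5 := key (2, 0, 1)
    have k2 := key (2, 1, 0)
    have k3 := key (3, 0, 0)
    simp only [Prod.mk.injEq, OfNat.one_ne_ofNat, OfNat.ofNat_ne_one, zero_ne_one, one_ne_zero,
      OfNat.ofNat_ne_zero, OfNat.zero_ne_ofNat, and_self, and_true, and_false,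
      if_true, if_false, mul_zero, mul_one, add_zero, zero_add, sub_zero,
      Nat.reduceEqDiff] at k1 k2 k3 k4 k5 k6
    simp only [k6, zero_mul, zero_add, zero_sub, neg_eq_zero] at k1 k2 k3 k4 k5
    exact hG2 (G2elt_eq_zero_of_coeffs k6 k4 k1 k5 k2 k3)
  have key := fun p => overlap_zxy hxy hzx hzy (β.coord (0, p)) (hkill p.1 p.2)
  have key' := overlap_zxy hxy hzx hzy (β.coord (0, 4, 0) ∘ₗ LinearMap.mulRight k y)
    fun t => by simpa [mul_assoc] using hkill 4 0 (t * y)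
  have zxx := fun p => apply_zxx hxy hzx hzy (β.coord (0, p)) (hkill p.1 p.2)
  have e1 := fun p => hcoord p 0 3 0
  have e2 := fun p => hcoord p 0 2 1
  have e3 := fun p => hcoord p 0 1 2
  have e4 := fun p => hcoord p 0 0 3
  have e5 := hcoord (0, 4, 0) 0 4 0
  simp only [pow_succ, pow_zero, one_mul, mul_one, mul_assoc, if_true] at e1 e2 e3 e4 e5
  have hE : E = -1 := by
    have hxxxy : x * (x * (x * y)) = y * (x * (x * x)) := by
      simp only [hxy, ← mul_assoc]
    have hzxxy : z * (x * (x * y)) = A • (x * (x * (x * x))) + y * (B • (x * (x * x)) +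
        C • (y * (x * x)) + E • (z * (x * x))) := by
      rw [show x * (x * y) = y * (x * x) by simp only [hxy, ← mul_assoc], ← mul_assoc, hzy]
      simp only [add_mul, mul_add, smul_mul_assoc, mul_smul_comm, mul_assoc, add_assoc]
    have hxxzy : x * (x * (z * y)) = A • (x * (x * (x * x))) + y * (B • (x * (x * x)) +
        C • (y * (x * x)) + E • (x * (x * z))) := by
      have hxy' : ∀ t, x * (y * t) = y * (x * t) := fun t => by
        rw [← mul_assoc, hxy, mul_assoc]
      rw [hzy]
      simp only [mul_add, mul_smul_comm, hxy, hxy', add_assoc]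
    simp only [LinearMap.comp_apply, LinearMap.mulRight_apply, mul_assoc, hxxxy, hzxxy, hxxzy,
      map_add, map_smul, hkill, e5, smul_eq_mul] at key'
    have : A ^ 2 * (E + 1) = 0 := by linear_combination -key'
    exact eq_neg_of_add_eq_zero_left ((mul_eq_zero.1 this).resolve_left (pow_ne_zero 2 hA0))
  simp only [e1, e2, e3, e4] at key zxx
  have k1 := key (3, 0)
  have k2 := key (2, 1)
  have k4 := key (0, 3)
  have z1 := zxx (3, 0)
  have z2 := zxx (2, 1)
  have z4 := zxx (0, 3)
  simp at k1 k2 k4 z1 z2 z4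
  have hd : d = -1 := by
    rw [k4.resolve_left hA0, mul_zero] at z4
    linear_combination -z4
  subst hd hE
  have he0 : e = 0 := by
    have : A * (e * A) = 0 := by linear_combination -(1 - a) * k2 - A * z2
    simpa [hA0] using this
  have hA1 : A = 1 := (hA he0).resolve_left hA0
  subst he0 hA1
  refine ⟨rfl, rfl, rfl, rfl, ?_⟩
  linear_combination -(1 - a) * k1 - z1
end
end
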